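/- There exist constants C > 0 and X₀ > 0 such that for every t in a given compact subset K of ℝ and every real x with |x| ≥ X₀, the bound |𝔖_t(x)| ≤ C |x|^{-1} log|x| holds, where C and X₀ depend only on K. This holds unconditionally, independent of the truth of the Riemann hypothesis. -/

import Mathlib

open MeasureTheory Real Complex Filter Set

noncomputable section

/-- The von Mangoldt function. -/
def vM (n : ℕ) : ℝ := ArithmeticFunction.vonMangoldt n

/-- The logarithmic derivative `Γ'/Γ` of the complex Gamma function. -/
def digamma (s : ℂ) : ℂ := deriv Complex.Gamma s / Complex.Gamma s

/-- The logarithmic derivative `Γ'/Γ` of the real Gamma function. -/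
def digammaR (x : ℝ) : ℝ := deriv Real.Gamma x / Real.Gamma x

/-- The Hurwitz–Lerch zeta function `Φ(z,s,a) = ∑_{n≥0} z^n (n+a)^{-s}`, real version. -/
def PhiR (z s a : ℝ) : ℝ := ∑' n : ℕ, z ^ n / ((n : ℝ) + a) ^ s

/-- The Hurwitz–Lerch zeta function `Φ(z,s,a) = ∑_{n≥0} z^n (n+a)^{-s}`, complex version. -/
def PhiC (z s a : ℂ) : ℂ := ∑' n : ℕ, z ^ n / ((n : ℂ) + a) ^ s

/-- The screw function `g(t)`, extended evenly to all of `ℝ`. -/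
def g (t : ℝ) : ℝ :=
  -4 * (Real.exp (|t| / 2) + Real.exp (-|t| / 2) - 2)
    - |t| / 2 * (digammaR (1 / 4) - Real.log π)
    - (1 / 4) * (PhiR 1 2 (1 / 4) - Real.exp (-|t| / 2) * PhiR (Real.exp (-2 * |t|)) 2 (1 / 4))
    + ∑ n ∈ Finset.Icc 1 ⌊Real.exp |t|⌋₊, vM n / Real.sqrt n * (|t| - Real.log n)

/-- `Z(s) = π^{-s/2} Γ(s/2) ζ(s)`. -/
def Zfun (s : ℂ) : ℂ := (π : ℂ) ^ (-s / 2) * Complex.Gamma (s / 2) * riemannZeta s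

/-- The function `𝔓_t(z)` (for `t ≥ 0`). -/
def Pfrak (t : ℝ) (z : ℂ) : ℂ :=
  4 * ((Real.exp (t / 2) : ℂ) - 1) / (1 - 2 * I * z)
    + 4 * ((Real.exp (-t / 2) : ℂ) - 1) / (1 + 2 * I * z)
    - ∑ n ∈ Finset.Icc 1 ⌊Real.exp t⌋₊,
        ((vM n / Real.sqrt n : ℝ) : ℂ) *
          ((Complex.exp (I * z * ((t : ℝ) - Real.log n)) - 1) / (I * z))
    + (Complex.exp (I * t * z) - 1) / (I * z) *
        (deriv Zfun (1 / 2 - I * z) / Zfun (1 / 2 - I * z) - (1 / 2) * (Real.log π : ℂ)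
          + (1 / 2) * _root_.digamma (1 / 4 + I * z / 2))
    - 1 / (2 * I * z) * (_root_.digamma (1 / 4) - _root_.digamma (1 / 4 + I * z / 2))
    - 1 / (2 * I * z) * (Real.exp (-t / 2) : ℂ) *
        (PhiC (Real.exp (-2 * t)) 1 (1 / 4) - PhiC (Real.exp (-2 * t)) 1 ((1 / 2 + I * z) / 2))

/-- The Riemann xi function `ξ(s) = (1/2)s(s-1)π^{-s/2}Γ(s/2)ζ(s)`. -/
def xi (s : ℂ) : ℂ := s * (s - 1) / 2 * (π : ℂ) ^ (-s / 2) * Complex.Gamma (s / 2) * riemannZeta s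

/-- `E(z) = ξ(1/2-iz) + ξ'(1/2-iz)`. -/
def Efun (z : ℂ) : ℂ := xi (1 / 2 - I * z) + deriv xi (1 / 2 - I * z)

/-- `Θ(z) = conj(E(conj z)) / E(z)`. -/
def Theta (z : ℂ) : ℂ := (starRingEnd ℂ) (Efun ((starRingEnd ℂ) z)) / Efun z

/-- The screw line `𝔖_t(z)`, extended to negative `t` by `𝔖_{-t} = 𝔖_t`. -/
def Sfrak (t : ℝ) (z : ℂ) : ℂ := I * (1 + Theta z) / (2 * (Real.sqrt π : ℂ)) * Pfrak |t| z

/-- The entire function `z ↦ ξ(1/2 - iz)`. -/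
def xiShift (z : ℂ) : ℂ := xi (1 / 2 - I * z)

/-- The set of zeros of `z ↦ ξ(1/2 - iz)` (not counting multiplicity). -/
def XiZeros : Set ℂ := {z | xiShift z = 0}

/-- The multiplicity of a zero of `z ↦ ξ(1/2 - iz)`. -/
def mult (γ : ℂ) : ℕ := sInf {n : ℕ | iteratedDeriv n xiShift γ ≠ 0}

/-- The kernel `G_g(t,u) = g(t-u) - g(t) - g(u) + g(0)`. -/
def Gg (t u : ℝ) : ℝ := g (t - u) - g t - g u + g 0

/-- `𝒫̂_φ(z) = ∫_ℝ 𝔖_t(z) φ(t) dt`. -/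
def Phat (φ : ℝ → ℂ) (z : ℂ) : ℂ := ∫ t : ℝ, Sfrak t z * φ t

/-- The Fourier-type transform `φ̂(z) = ∫_ℝ φ(t) e^{izt} dt`. -/
def FT (φ : ℝ → ℂ) (z : ℂ) : ℂ := ∫ t : ℝ, φ t * Complex.exp (I * z * t)

/-- The finite Gamma products are dominated by `Γ (re s)` on the right half-plane. -/
lemma norm_GammaSeq_le {s : ℂ} (hs : 0 < s.re) {n : ℕ} (hn : n ≠ 0) :
    ‖Complex.GammaSeq s n‖ ≤ Real.Gamma s.re := by
  have hn0 : (0 : ℝ) < n := by exact_mod_cast Nat.pos_of_ne_zero hn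
  have hpos : ∀ j : ℕ, 0 < s.re + j := fun j => by positivity
  have hfac : (0 : ℝ) < n.factorial := by exact_mod_cast n.factorial_pos
  have hprod : 0 < ∏ j ∈ Finset.range (n + 1), (s.re + j) := Finset.prod_pos fun j _ => hpos j
  have hle : ‖Complex.GammaSeq s n‖
      ≤ (n : ℝ) ^ s.re * n.factorial / ∏ j ∈ Finset.range (n + 1), (s.re + j) := by
    rw [Complex.GammaSeq, norm_div, norm_mul, Complex.norm_natCast, norm_prod,
      Complex.norm_natCast_cpow_of_pos (Nat.pos_of_ne_zero hn)]
    gcongr with j hj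
    simpa using Complex.re_le_norm (s + j)
  refine hle.trans ?_
  have hlog := Real.BohrMollerup.ge_logGammaSeq (f := Real.log ∘ Real.Gamma) (x := s.re) (n := n)
    Real.convexOn_log_Gamma (fun {y} hy => by
      simp only [Function.comp_apply]
      rw [Real.Gamma_add_one hy.ne', Real.log_mul hy.ne' (Real.Gamma_pos_of_pos hy).ne', add_comm])
    hs hn
  simp only [Function.comp_apply, Real.Gamma_one, Real.log_one, zero_add,
    Real.BohrMollerup.logGammaSeq] at hlog
  rw [← Real.log_le_log_iff (by positivity) (Real.Gamma_pos_of_pos hs),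
    Real.log_div (by positivity) hprod.ne', Real.log_mul (by positivity) hfac.ne',
    Real.log_rpow hn0, Real.log_prod fun j _ => (hpos j).ne']
  exact hlog

lemma add_natCast_ne_zero_of_re_pos {s : ℂ} (hs : 0 < s.re) (j : ℕ) : s + j ≠ 0 := by
  intro h
  have h' := congrArg Complex.re h
  simp only [Complex.add_re, Complex.natCast_re, Complex.zero_re] at h'
  have : (0 : ℝ) ≤ j := j.cast_nonneg
  linarith

lemma differentiableAt_natCast_cpow {n : ℕ} (hn : n ≠ 0) (s : ℂ) :
    DifferentiableAt ℂ (fun s : ℂ => (n : ℂ) ^ s) s :=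
  differentiableAt_id.const_cpow (Or.inl (Nat.cast_ne_zero.mpr hn))

lemma differentiableAt_GammaSeq {s : ℂ} (hs : 0 < s.re) {n : ℕ} (hn : n ≠ 0) :
    DifferentiableAt ℂ (fun s => Complex.GammaSeq s n) s := by
  unfold Complex.GammaSeq
  refine ((differentiableAt_natCast_cpow hn s).mul_const _).div ?_ ?_
  · fun_prop
  · exact Finset.prod_ne_zero_iff.mpr fun j _ => add_natCast_ne_zero_of_re_pos hs j

lemma differentiableAt_Gamma_of_re_pos {s : ℂ} (hs : 0 < s.re) :
    DifferentiableAt ℂ Complex.Gamma s :=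
  Complex.differentiableAt_Gamma s fun m h => add_natCast_ne_zero_of_re_pos hs m (by simp [h])

lemma isOpen_re_pos : IsOpen {s : ℂ | 0 < s.re} := isOpen_lt continuous_const Complex.continuous_re

lemma tendsto_deriv_GammaSeq {s : ℂ} (hs : 0 < s.re) :
    Tendsto (fun n : ℕ => deriv (fun s => Complex.GammaSeq s n) s) atTop
      (nhds (deriv Complex.Gamma s)) := by
  have hR : 0 < s.re / 2 := by positivity
  have hball : Metric.closedBall s (s.re / 2) ⊆ {s : ℂ | 0 < s.re} := by
    intro w hw
    have h1 : ‖w - s‖ ≤ s.re / 2 := by simpa [dist_eq_norm] using hw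
    have h2 := (abs_le.mp (Complex.abs_re_le_norm (w - s))).1
    simp only [Complex.sub_re] at h2
    simp only [Set.mem_ofPred_eq]
    linarith
  have hcircle : ∀ θ : ℝ, 0 < (circleMap s (s.re / 2) θ).re := fun θ =>
    hball (circleMap_mem_closedBall s hR.le θ)
  have hcauchy : ∀ f : ℂ → ℂ, (∀ w : ℂ, 0 < w.re → DifferentiableAt ℂ f w) →
      (2 * (π : ℂ) * I)⁻¹ • (∮ z in C(s, s.re / 2), ((z - s) ^ 2)⁻¹ • f z) = deriv f s :=
    fun f hf => Complex.two_pi_I_inv_smul_circleIntegral_sub_sq_inv_smul_of_differentiable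
      isOpen_re_pos hball (fun w hw => (hf w hw).differentiableWithinAt) (Metric.mem_ball_self hR)
  have hcont : ∀ f : ℂ → ℂ, (∀ w : ℂ, 0 < w.re → DifferentiableAt ℂ f w) →
      Continuous fun θ : ℝ => f (circleMap s (s.re / 2) θ) := fun f hf =>
    continuous_iff_continuousAt.mpr fun θ =>
      (hf _ (hcircle θ)).continuousAt.comp (continuous_circleMap s _).continuousAt
  have hden : ∀ θ : ℝ, circleMap s (s.re / 2) θ - s ≠ 0 := fun θ =>
    sub_ne_zero.mpr (circleMap_ne_center hR.ne')
  have hker : Continuous fun θ : ℝ => ((circleMap s (s.re / 2) θ - s) ^ 2)⁻¹ :=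
    ((continuous_circleMap s _).sub continuous_const |>.pow 2).inv₀ fun θ => pow_ne_zero 2 (hden θ)
  have hder : Continuous fun θ : ℝ => deriv (circleMap s (s.re / 2)) θ := by
    simp only [deriv_circleMap]
    fun_prop
  have hlim : Tendsto (fun n : ℕ => (2 * (π : ℂ) * I)⁻¹ •
      (∮ z in C(s, s.re / 2), ((z - s) ^ 2)⁻¹ • Complex.GammaSeq z n)) atTop
      (nhds ((2 * (π : ℂ) * I)⁻¹ •
        (∮ z in C(s, s.re / 2), ((z - s) ^ 2)⁻¹ • Complex.Gamma z))) := by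
    refine Tendsto.const_smul ?_ _
    unfold circleIntegral
    refine intervalIntegral.tendsto_integral_filter_of_dominated_convergence
      (fun θ => ‖deriv (circleMap s (s.re / 2)) θ‖ * (‖((circleMap s (s.re / 2) θ - s) ^ 2)⁻¹‖ *
        Real.Gamma (circleMap s (s.re / 2) θ).re)) ?_ ?_ ?_ ?_
    · filter_upwards [eventually_ne_atTop 0] with n hn
      exact (hder.smul (hker.smul
        (hcont _ fun w hw => differentiableAt_GammaSeq hw hn))).aestronglyMeasurable
    · filter_upwards [eventually_ne_atTop 0] with n hn
      refine Eventually.of_forall fun θ _ => ?_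
      rw [norm_smul, norm_smul]
      gcongr
      exact norm_GammaSeq_le (hcircle θ) hn
    · refine Continuous.intervalIntegrable ?_ _ _
      refine hder.norm.mul (hker.norm.mul ?_)
      refine continuous_iff_continuousAt.mpr fun θ => ?_
      refine ContinuousAt.comp (f := fun θ : ℝ => (circleMap s (s.re / 2) θ).re)
        (Real.differentiableAt_Gamma fun m h => ?_).continuousAt
        (Complex.continuous_re.comp (continuous_circleMap s _)).continuousAt
      have := hcircle θ
      have hm : (0 : ℝ) ≤ m := m.cast_nonneg
      linarith
    · exact Eventually.of_forall fun θ _ =>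
        ((Complex.GammaSeq_tendsto_Gamma _).const_smul _).const_smul _
  rw [hcauchy _ fun w hw => differentiableAt_Gamma_of_re_pos hw] at hlim
  refine hlim.congr' ?_
  filter_upwards [eventually_ne_atTop 0] with n hn
  exact hcauchy _ fun w hw => differentiableAt_GammaSeq hw hn

lemma logDeriv_GammaSeq {s : ℂ} (hs : 0 < s.re) {n : ℕ} (hn : n ≠ 0) :
    logDeriv (fun s => Complex.GammaSeq s n) s
      = Complex.log n - ∑ j ∈ Finset.range (n + 1), 1 / (s + j) := by
  have hn' : (n : ℂ) ≠ 0 := Nat.cast_ne_zero.mpr hn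
  have hpow : (n : ℂ) ^ s ≠ 0 := by simp [Complex.cpow_eq_zero_iff, hn']
  have hfac : (n.factorial : ℂ) ≠ 0 := by exact_mod_cast n.factorial_ne_zero
  unfold Complex.GammaSeq
  rw [logDeriv_div (f := fun s : ℂ => (n : ℂ) ^ s * n.factorial)
    (g := fun s : ℂ => ∏ j ∈ Finset.range (n + 1), (s + j)) s (mul_ne_zero hpow hfac)
    (Finset.prod_ne_zero_iff.mpr fun j _ => add_natCast_ne_zero_of_re_pos hs j)
    ((differentiableAt_natCast_cpow hn s).mul_const _) (by fun_prop),
    logDeriv_prod (fun j _ => add_natCast_ne_zero_of_re_pos hs j) (fun j _ => by fun_prop)]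
  congr 1
  · have hder : HasDerivAt (fun s : ℂ => (n : ℂ) ^ s) ((n : ℂ) ^ s * Complex.log n) s := by
      simpa using (hasDerivAt_id s).const_cpow (Or.inl hn')
    rw [logDeriv_mul_const _ _ hfac, logDeriv_apply, hder.deriv]
    field_simp
  · refine Finset.sum_congr rfl fun j _ => ?_
    simp [logDeriv_apply]

/-- The series for a difference of values of the digamma function. -/
lemma tendsto_sum_digamma_sub {a s : ℂ} (ha : 0 < a.re) (hs : 0 < s.re) :
    Tendsto (fun n : ℕ => ∑ j ∈ Finset.range (n + 1), (1 / ((j : ℂ) + a) - 1 / ((j : ℂ) + s))) atTop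
      (nhds (_root_.digamma s - _root_.digamma a)) := by
  have key : ∀ w : ℂ, 0 < w.re → Tendsto (fun n : ℕ =>
      Complex.log n - ∑ j ∈ Finset.range (n + 1), 1 / (w + j)) atTop
      (nhds (_root_.digamma w)) := fun w hw => by
    refine ((tendsto_deriv_GammaSeq hw).div (Complex.GammaSeq_tendsto_Gamma w)
      (Complex.Gamma_ne_zero_of_re_pos hw)).congr' ?_
    filter_upwards [eventually_ne_atTop 0] with n hn
    rw [← logDeriv_GammaSeq hw hn, logDeriv_apply]
    rfl
  refine ((key s hs).sub (key a ha)).congr fun n => ?_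
  rw [Finset.sum_sub_distrib]
  simp only [add_comm s, add_comm a]
  ring

lemma sum_one_div_sub_one_div_add_le_harmonic (m N : ℕ) :
    ∑ j ∈ Finset.range N, (1 / ((j : ℝ) + 1) - 1 / ((j : ℝ) + 1 + m)) ≤ harmonic m := by
  have hshift : ∑ j ∈ Finset.range N, 1 / ((j : ℝ) + 1 + m)
      = (harmonic (m + N) : ℝ) - harmonic m := by
    unfold harmonic
    rw [Finset.sum_range_add]
    push_cast
    rw [add_sub_cancel_left]
    refine Finset.sum_congr rfl fun j _ => ?_
    rw [one_div]
    congr 1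
    ring
  have hharm : ∑ j ∈ Finset.range N, 1 / ((j : ℝ) + 1) = (harmonic N : ℝ) := by
    simp [harmonic]
  have hmono : (harmonic N : ℝ) ≤ harmonic (m + N) := by
    unfold harmonic
    push_cast
    exact Finset.sum_le_sum_of_subset_of_nonneg
      (Finset.range_subset_range.mpr (Nat.le_add_left N m)) fun j _ _ => by positivity
  rw [Finset.sum_sub_distrib, hshift, hharm]
  linarith

lemma norm_one_div_sub_one_div_add_le {r y : ℝ} {m k : ℝ} (hk : 0 < k) (hkr : k ≤ r)
    (hym : |y| ≤ m) :
    ‖1 / (r : ℂ) - 1 / ((r : ℂ) + I * y)‖ ≤ 2 * (1 / k - 1 / (k + m)) := by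
  have hr : 0 < r := hk.trans_le hkr
  have hm : 0 ≤ m := (abs_nonneg y).trans hym
  have hre : r ≤ ‖(r : ℂ) + I * y‖ := by
    simpa using Complex.re_le_norm ((r : ℂ) + I * y)
  have him : |y| ≤ ‖(r : ℂ) + I * y‖ := by
    simpa using Complex.abs_im_le_norm ((r : ℂ) + I * y)
  have hne : (r : ℂ) + I * y ≠ 0 := norm_pos_iff.mp (hr.trans_le hre)
  have hrne : (r : ℂ) ≠ 0 := by exact_mod_cast hr.ne'
  have heq : 1 / (r : ℂ) - 1 / ((r : ℂ) + I * y) = I * y / (r * ((r : ℂ) + I * y)) := by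
    field_simp
    ring
  have hnorm : ‖1 / (r : ℂ) - 1 / ((r : ℂ) + I * y)‖ = |y| / (r * ‖(r : ℂ) + I * y‖) := by
    rw [heq]
    simp [abs_of_pos hr]
  have hsum : k + |y| ≤ 2 * ‖(r : ℂ) + I * y‖ := by linarith
  have hy : 0 ≤ |y| := abs_nonneg y
  calc ‖1 / (r : ℂ) - 1 / ((r : ℂ) + I * y)‖ = |y| / (r * ‖(r : ℂ) + I * y‖) := hnorm
    _ ≤ |y| / (k * ((k + |y|) / 2)) := by
        gcongr
        linarith
    _ = 2 * (1 / k - 1 / (k + |y|)) := by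
        field_simp
        ring
    _ ≤ 2 * (1 / k - 1 / (k + m)) := by gcongr

/-- Partial sums of the digamma-type series grow at most logarithmically in the height. -/
lemma sum_norm_one_div_sub_le {x : ℝ} (hx : 2 ≤ |x|) (N : ℕ) :
    ∑ j ∈ Finset.range N, ‖1 / ((j : ℂ) + 1 / 4) - 1 / ((j : ℂ) + (1 / 4 + I * x / 2))‖
      ≤ 10 + 2 * Real.log |x| := by
  set m : ℕ := ⌈|x / 2|⌉₊ with hm
  have hxm : |x / 2| ≤ m := Nat.le_ceil _
  have habs : |x / 2| = |x| / 2 := by rw [abs_div]; norm_num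
  have hmx : (m : ℝ) ≤ |x| := by
    have := Nat.ceil_lt_add_one (abs_nonneg (x / 2))
    rw [habs] at this
    rw [hm, habs]
    linarith
  have hmpos : (0 : ℝ) < m := by
    have : 0 < |x / 2| := by rw [habs]; linarith
    linarith
  have hterm : ∀ j : ℕ, 1 / ((j : ℂ) + 1 / 4) - 1 / ((j : ℂ) + (1 / 4 + I * x / 2))
      = 1 / (((j : ℝ) + 1 / 4 : ℝ) : ℂ) - 1 / ((((j : ℝ) + 1 / 4 : ℝ) : ℂ) + I * (x / 2 : ℝ)) := by
    intro j
    push_cast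
    congr 2
    ring
  have hfirst : ∀ j : ℕ, ‖1 / ((j : ℂ) + 1 / 4) - 1 / ((j : ℂ) + (1 / 4 + I * x / 2))‖
      ≤ if j = 0 then 8 else 2 * (1 / (j : ℝ) - 1 / ((j : ℝ) + m)) := by
    intro j
    rw [hterm]
    split_ifs with hj
    · subst hj
      refine (norm_one_div_sub_one_div_add_le (k := 1 / 4) (by norm_num) (by norm_num) hxm).trans ?_
      have : 0 ≤ 1 / ((1 : ℝ) / 4 + m) := by positivity
      linarith
    · exact norm_one_div_sub_one_div_add_le (by exact_mod_cast Nat.pos_of_ne_zero hj)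
        (by linarith) hxm
  refine (Finset.sum_le_sum_of_subset_of_nonneg
    (Finset.range_subset_range.mpr (Nat.le_succ N)) fun j _ _ => norm_nonneg _).trans
    ((Finset.sum_le_sum fun j _ => hfirst j).trans ?_)
  rw [Finset.sum_range_succ']
  simp only [Nat.succ_ne_zero, if_false, if_true, Nat.cast_add, Nat.cast_one]
  rw [← Finset.mul_sum]
  have h1 := sum_one_div_sub_one_div_add_le_harmonic m N
  have h2 := harmonic_le_one_add_log m
  have h3 : Real.log m ≤ Real.log |x| := Real.log_le_log hmpos hmx
  linarith

lemma norm_digamma_sub_le {x : ℝ} (hx : 2 ≤ |x|) :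
    ‖_root_.digamma (1 / 4 + I * x / 2) - _root_.digamma (1 / 4)‖ ≤ 10 + 2 * Real.log |x| := by
  have hre : (0 : ℝ) < (1 / 4 + I * x / 2 : ℂ).re := by simp
  have hre' : (0 : ℝ) < (1 / 4 : ℂ).re := by norm_num
  refine le_of_tendsto (tendsto_sum_digamma_sub hre' hre).norm (Eventually.of_forall fun n => ?_)
  exact (norm_sum_le _ _).trans (sum_norm_one_div_sub_le hx _)

/-- The bound holds also where both Lerch series diverge, since then both values are `0`. -/
lemma norm_PhiC_sub_le {x : ℝ} (hx : 2 ≤ |x|) {z : ℂ} (hz : ‖z‖ ≤ 1) :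
    ‖PhiC z 1 (1 / 4) - PhiC z 1 ((1 / 2 + I * x) / 2)‖ ≤ 10 + 2 * Real.log |x| := by
  have harg : (1 / 2 + I * x) / 2 = 1 / 4 + I * (x : ℂ) / 2 := by ring
  have hnonneg : 0 ≤ 10 + 2 * Real.log |x| := by
    have := Real.log_nonneg (show 1 ≤ |x| by linarith)
    linarith
  rw [harg]
  unfold PhiC
  simp only [Complex.cpow_one]
  have hbound : ∀ N : ℕ, ∑ j ∈ Finset.range N, ‖z ^ j / ((j : ℂ) + 1 / 4)
      - z ^ j / ((j : ℂ) + (1 / 4 + I * x / 2))‖ ≤ 10 + 2 * Real.log |x| := by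
    intro N
    refine (Finset.sum_le_sum fun j _ => ?_).trans (sum_norm_one_div_sub_le hx N)
    rw [div_eq_mul_one_div, div_eq_mul_one_div (z ^ j) ((j : ℂ) + (1 / 4 + I * x / 2)), ← mul_sub,
      norm_mul, norm_pow]
    exact mul_le_of_le_one_left (norm_nonneg _) (pow_le_one₀ (norm_nonneg z) hz)
  have hsum := summable_of_sum_range_le (fun j => norm_nonneg _) hbound
  by_cases hf : Summable fun j : ℕ => z ^ j / ((j : ℂ) + 1 / 4)
  · have hg : Summable fun j : ℕ => z ^ j / ((j : ℂ) + (1 / 4 + I * x / 2)) := by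
      simpa using hf.sub hsum.of_norm
    rw [← hf.tsum_sub hg]
    exact (norm_tsum_le_tsum_norm hsum).trans
      (Real.tsum_le_of_sum_range_le (fun j => norm_nonneg _) hbound)
  · have hg : ¬ Summable fun j : ℕ => z ^ j / ((j : ℂ) + (1 / 4 + I * x / 2)) := fun hg =>
      hf (by simpa using hsum.of_norm.add hg)
    rw [tsum_eq_zero_of_not_summable hf, tsum_eq_zero_of_not_summable hg]
    simpa using hnonneg

lemma xi_eq_mul_Zfun (s : ℂ) : xi s = s * (s - 1) / 2 * Zfun s := by
  unfold xi Zfun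
  ring

lemma xi_one_sub {s : ℂ} (h0 : 0 < s.re) (h1 : s.re < 1) : xi (1 - s) = xi s := by
  have key : ∀ w : ℂ, 0 < w.re → Zfun w = completedRiemannZeta w := fun w hw => by
    have hw0 : w ≠ 0 := fun h => by simp [h] at hw
    rw [Zfun, ← Complex.Gammaℝ_def, riemannZeta_def_of_ne_zero hw0,
      mul_div_cancel₀ _ (Complex.Gammaℝ_ne_zero_of_re_pos hw)]
  rw [xi_eq_mul_Zfun, xi_eq_mul_Zfun, key s h0, key (1 - s) (by simpa using h1),
    completedRiemannZeta_one_sub]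
  ring

lemma xi_conj (s : ℂ) : xi ((starRingEnd ℂ) s) = (starRingEnd ℂ) (xi s) := by
  have hpi : (π : ℂ).arg ≠ π := by
    rw [Complex.arg_ofReal_of_nonneg Real.pi_pos.le]
    exact Real.pi_pos.ne
  have htwo : (starRingEnd ℂ) 2 = 2 := Complex.conj_ofNat 2
  have hdiv : ∀ w : ℂ, (starRingEnd ℂ) w / 2 = (starRingEnd ℂ) (w / 2) := fun w => by simp [htwo]
  have hneg : -(starRingEnd ℂ) s / 2 = (starRingEnd ℂ) (-s / 2) := by simp [htwo]
  unfold xi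
  rw [hneg, Complex.cpow_conj _ _ hpi, hdiv s, Complex.Gamma_conj, riemannZeta_conj]
  simp [htwo]

lemma deriv_xi_conj (s : ℂ) : deriv xi ((starRingEnd ℂ) s) = (starRingEnd ℂ) (deriv xi s) := by
  have h : (starRingEnd ℂ) ∘ xi ∘ (starRingEnd ℂ) = xi := by
    ext w
    simp [xi_conj]
  have h' := congrFun (deriv_conj_conj (f := xi)) ((starRingEnd ℂ) s)
  rw [h] at h'
  simpa using h'

lemma deriv_xi_one_sub {s : ℂ} (h0 : 0 < s.re) (h1 : s.re < 1) :
    deriv xi (1 - s) = -deriv xi s := by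
  have hev : (fun w => xi (1 - w)) =ᶠ[nhds s] xi := by
    filter_upwards [isOpen_re_pos.mem_nhds h0,
      (isOpen_lt Complex.continuous_re continuous_const).mem_nhds h1] with w hw0 hw1
    exact xi_one_sub hw0 hw1
  rw [← hev.deriv_eq, deriv_comp_const_sub, neg_neg]

lemma conj_half_sub_I_mul (x : ℝ) :
    (starRingEnd ℂ) (1 / 2 - I * (x : ℂ)) = 1 - (1 / 2 - I * (x : ℂ)) := by
  have htwo : (starRingEnd ℂ) 2 = 2 := Complex.conj_ofNat 2
  simp [htwo]
  ring

lemma conj_Efun_ofReal (x : ℝ) :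
    (starRingEnd ℂ) (Efun x) = xi (1 / 2 - I * x) - deriv xi (1 / 2 - I * x) := by
  have h0 : 0 < (1 / 2 - I * (x : ℂ)).re := by simp
  have h1 : (1 / 2 - I * (x : ℂ)).re < 1 := by norm_num
  rw [Efun, map_add, ← xi_conj, ← deriv_xi_conj, conj_half_sub_I_mul, xi_one_sub h0 h1,
    deriv_xi_one_sub h0 h1]
  ring

lemma norm_Theta_ofReal_le (x : ℝ) : ‖Theta x‖ ≤ 1 := by
  rw [Theta, Complex.conj_ofReal, norm_div, Complex.norm_conj]
  exact div_self_le_one _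

lemma norm_one_add_Theta_ofReal_le (x : ℝ) : ‖1 + Theta x‖ ≤ 2 := by
  have h := norm_add_le 1 (Theta x)
  rw [norm_one] at h
  linarith [norm_Theta_ofReal_le x]

lemma differentiableAt_Zfun {s : ℂ} (h0 : 0 < s.re) (h1 : s ≠ 1) : DifferentiableAt ℂ Zfun s := by
  unfold Zfun
  have hpi : (π : ℂ) ≠ 0 := by exact_mod_cast Real.pi_ne_zero
  have hre : 0 < (s / 2).re := by simpa using h0
  refine DifferentiableAt.mul (DifferentiableAt.mul ?_ ?_) (differentiableAt_riemannZeta h1)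
  · exact DifferentiableAt.const_cpow (by fun_prop) (Or.inl hpi)
  · exact (differentiableAt_Gamma_of_re_pos hre).comp s (f := fun s : ℂ => s / 2) (by fun_prop)

lemma abs_le_norm_half_sub_I_mul (x : ℝ) : |x| ≤ ‖1 / 2 - I * (x : ℂ)‖ := by
  simpa using Complex.abs_im_le_norm (1 / 2 - I * (x : ℂ))

lemma abs_le_norm_half_sub_I_mul_sub_one (x : ℝ) : |x| ≤ ‖1 / 2 - I * (x : ℂ) - 1‖ := by
  simpa using Complex.abs_im_le_norm (1 / 2 - I * (x : ℂ) - 1)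

/-- The factor `1 + Θ` cancels the poles of `Z'/Z` on the critical line. -/
lemma norm_one_add_Theta_mul_logDeriv_Zfun_le {x : ℝ} (hx : 1 ≤ |x|) :
    ‖(1 + Theta x) * (deriv Zfun (1 / 2 - I * x) / Zfun (1 / 2 - I * x))‖ ≤ 6 := by
  have hns : 1 ≤ ‖1 / 2 - I * (x : ℂ)‖ := hx.trans (abs_le_norm_half_sub_I_mul x)
  have hns' : 1 ≤ ‖1 / 2 - I * (x : ℂ) - 1‖ := hx.trans (abs_le_norm_half_sub_I_mul_sub_one x)
  have hre : 0 < (1 / 2 - I * (x : ℂ)).re := by simp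
  have hconj := conj_Efun_ofReal x
  have hE : Efun x = xi (1 / 2 - I * x) + deriv xi (1 / 2 - I * x) := rfl
  have hΘ : Theta x = (starRingEnd ℂ) (Efun x) / Efun x := by rw [Theta, Complex.conj_ofReal]
  set s : ℂ := 1 / 2 - I * x
  have hs0 : s ≠ 0 := norm_pos_iff.mp (by linarith)
  have hs1 : s - 1 ≠ 0 := norm_pos_iff.mp (by linarith)
  by_cases hZ : Zfun s = 0
  · simp [hZ]
  have hxi : xi s ≠ 0 := by
    rw [xi_eq_mul_Zfun]
    exact mul_ne_zero (div_ne_zero (mul_ne_zero hs0 hs1) two_ne_zero) hZ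
  have hEne : Efun x ≠ 0 := by
    intro h
    rw [h, map_zero] at hconj
    rw [h] at hE
    apply hxi
    linear_combination (-1 / 2 : ℂ) * hE - (1 / 2 : ℂ) * hconj
  have hderiv : deriv xi s = (2 * s - 1) / 2 * Zfun s + s * (s - 1) / 2 * deriv Zfun s := by
    have hpoly : HasDerivAt (fun w : ℂ => w * (w - 1) / 2) ((2 * s - 1) / 2) s := by
      have h := ((hasDerivAt_id s).mul ((hasDerivAt_id s).sub_const 1)).div_const 2
      exact h.congr_deriv (by simp only [id]; ring)
    have hmul := hpoly.mul (differentiableAt_Zfun hre (sub_ne_zero.mp hs1)).hasDerivAt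
    exact (funext xi_eq_mul_Zfun : xi = _) ▸ hmul.deriv
  have hlog : deriv Zfun s / Zfun s = deriv xi s / xi s - (1 / s + 1 / (s - 1)) := by
    rw [hderiv, xi_eq_mul_Zfun]
    field_simp
    ring
  have hcancel : (1 + Theta x) * (deriv xi s / xi s) = 1 - Theta x := by
    have hne : xi s + deriv xi s ≠ 0 := hE ▸ hEne
    rw [hΘ, hconj, hE]
    field_simp
    ring
  have hbound : ‖1 / s + 1 / (s - 1)‖ ≤ 2 := by
    refine (norm_add_le _ _).trans ?_
    rw [norm_div, norm_div, norm_one]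
    have h1 := (div_le_one (by linarith)).mpr hns
    have h2 := (div_le_one (by linarith)).mpr hns'
    linarith
  rw [hlog, mul_sub, hcancel]
  have h1 : ‖1 - Theta x‖ ≤ 2 := by
    have h := norm_sub_le 1 (Theta x)
    rw [norm_one] at h
    linarith [norm_Theta_ofReal_le x]
  have h2 : ‖(1 + Theta x) * (1 / s + 1 / (s - 1))‖ ≤ 2 * 2 := by
    rw [norm_mul]
    exact mul_le_mul (norm_one_add_Theta_ofReal_le x) hbound (norm_nonneg _) (by norm_num)
  linarith [norm_sub_le (1 - Theta x) ((1 + Theta x) * (1 / s + 1 / (s - 1)))]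

lemma norm_exp_I_mul_ofReal_sub_one_div_le (u x : ℝ) :
    ‖(Complex.exp (I * u) - 1) / (I * x)‖ ≤ 2 * |x|⁻¹ := by
  have h : ‖Complex.exp (I * u) - 1‖ ≤ 2 := by
    refine (norm_sub_le _ _).trans ?_
    rw [mul_comm, Complex.norm_exp_ofReal_mul_I, norm_one]
    norm_num
  rw [norm_div, norm_mul, Complex.norm_I, one_mul, Complex.norm_real, Real.norm_eq_abs,
    div_eq_mul_inv]
  gcongr

lemma norm_vonMangoldt_sum_le {t T : ℝ} (htT : t ≤ T) (x : ℝ) :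
    ‖∑ n ∈ Finset.Icc 1 ⌊Real.exp t⌋₊, ((vM n / Real.sqrt n : ℝ) : ℂ) *
        ((Complex.exp (I * x * ((t : ℝ) - Real.log n)) - 1) / (I * x))‖
      ≤ (∑ n ∈ Finset.Icc 1 ⌊Real.exp T⌋₊, vM n / Real.sqrt n) * (2 * |x|⁻¹) := by
  have hnonneg : ∀ n : ℕ, 0 ≤ vM n / Real.sqrt n := fun n =>
    div_nonneg ArithmeticFunction.vonMangoldt_nonneg (Real.sqrt_nonneg _)
  refine (norm_sum_le _ _).trans ?_
  rw [Finset.sum_mul]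
  refine (Finset.sum_le_sum fun n _ => ?_).trans (Finset.sum_le_sum_of_subset_of_nonneg
    (Finset.Icc_subset_Icc_right (Nat.floor_le_floor (Real.exp_le_exp.mpr htT)))
    fun n _ _ => mul_nonneg (hnonneg n) (by positivity))
  rw [norm_mul, Complex.norm_real, Real.norm_of_nonneg (hnonneg n)]
  refine mul_le_mul_of_nonneg_left ?_ (hnonneg n)
  have h := norm_exp_I_mul_ofReal_sub_one_div_le (x * (t - Real.log n)) x
  rw [Complex.ofReal_mul, Complex.ofReal_sub] at h
  rwa [← mul_assoc] at h

lemma norm_four_mul_div_le {x : ℝ} {a w : ℂ} {b : ℝ} (hx : 0 < |x|) (ha : ‖a‖ ≤ b)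
    (hw : |x| ≤ ‖w‖) : ‖4 * a / w‖ ≤ 4 * b * |x|⁻¹ := by
  have hb : 0 ≤ b := (norm_nonneg a).trans ha
  rw [norm_div, norm_mul, Complex.norm_ofNat, div_eq_mul_inv]
  gcongr

/-- All of `𝔓_t(x)` except the `Z'/Z` term is `O(log |x| / |x|)`, uniformly for `0 ≤ t ≤ T`. -/
lemma exists_norm_Pfrak_sub_le (T : ℝ) :
    ∃ C : ℝ, 0 ≤ C ∧ ∀ t : ℝ, 0 ≤ t → t ≤ T → ∀ x : ℝ, 3 ≤ |x| →
      ‖Pfrak t x - (Complex.exp (I * t * x) - 1) / (I * x) *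
        (deriv Zfun (1 / 2 - I * x) / Zfun (1 / 2 - I * x))‖ ≤ C * |x|⁻¹ * Real.log |x| := by
  set M : ℝ := ∑ n ∈ Finset.Icc 1 ⌊Real.exp T⌋₊, vM n / Real.sqrt n with hM
  have hM0 : 0 ≤ M := Finset.sum_nonneg fun n _ =>
    div_nonneg ArithmeticFunction.vonMangoldt_nonneg (Real.sqrt_nonneg _)
  have hlogpi : 0 ≤ Real.log π := Real.log_nonneg (by linarith [Real.pi_gt_three])
  set D : ℝ := ‖_root_.digamma (1 / 4)‖ with hD
  have hD0 : 0 ≤ D := norm_nonneg _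
  refine ⟨4 * Real.exp (T / 2) + 4 + 2 * M + Real.log π + D + 24, by positivity, ?_⟩
  intro t ht0 htT x hx
  have hxpos : 0 < |x| := by linarith
  set L : ℝ := Real.log |x| with hL
  set r : ℝ := |x|⁻¹ with hr
  have hr0 : 0 < r := inv_pos.mpr hxpos
  have hL1 : 1 ≤ L := by
    rw [hL, Real.le_log_iff_exp_le hxpos]
    linarith [Real.exp_one_lt_d9]
  have hA : ‖4 * ((Real.exp (t / 2) : ℂ) - 1) / (1 - 2 * I * x)‖ ≤ 4 * Real.exp (T / 2) * r := by
    refine norm_four_mul_div_le hxpos ?_ ?_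
    · have h1 : 1 ≤ Real.exp (t / 2) := Real.one_le_exp (by linarith)
      have h2 : Real.exp (t / 2) ≤ Real.exp (T / 2) := Real.exp_le_exp.mpr (by linarith)
      rw [← Complex.ofReal_one, ← Complex.ofReal_sub, Complex.norm_real,
        Real.norm_of_nonneg (by linarith)]
      linarith
    · have h := Complex.abs_im_le_norm (1 - 2 * I * (x : ℂ))
      simp at h
      linarith
  have hB : ‖4 * ((Real.exp (-t / 2) : ℂ) - 1) / (1 + 2 * I * x)‖ ≤ 4 * 1 * r := by
    refine norm_four_mul_div_le hxpos ?_ ?_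
    · have h1 : Real.exp (-t / 2) ≤ 1 := Real.exp_le_one_iff.mpr (by linarith)
      have h2 := Real.exp_pos (-t / 2)
      rw [← Complex.ofReal_one, ← Complex.ofReal_sub, Complex.norm_real, Real.norm_eq_abs, abs_le]
      constructor <;> linarith
    · have h := Complex.abs_im_le_norm (1 + 2 * I * (x : ℂ))
      simp at h
      linarith
  have hS := norm_vonMangoldt_sum_le htT x
  have hψ := norm_digamma_sub_le (x := x) (by linarith)
  have hΦ := norm_PhiC_sub_le (x := x) (by linarith) (z := (Real.exp (-2 * t) : ℂ)) (by
    rw [Complex.norm_real, Real.norm_of_nonneg (Real.exp_pos _).le]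
    exact Real.exp_le_one_iff.mpr (by linarith))
  have hexp : ‖(Complex.exp (I * t * x) - 1) / (I * x)‖ ≤ 2 * r := by
    have h := norm_exp_I_mul_ofReal_sub_one_div_le (t * x) x
    push_cast at h
    rwa [← mul_assoc] at h
  have hhalf : ‖1 / (2 * I * (x : ℂ))‖ = r / 2 := by
    rw [norm_div, norm_mul, norm_mul, Complex.norm_I, Complex.norm_real, Real.norm_eq_abs, norm_one,
      Complex.norm_ofNat, hr]
    field_simp
  have hψ' : ‖-((1 / 2) * (Real.log π : ℂ)) + (1 / 2) * _root_.digamma (1 / 4 + I * x / 2)‖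
      ≤ (Real.log π + D + (10 + 2 * L)) / 2 := by
    have h1 : ‖_root_.digamma (1 / 4 + I * x / 2)‖ ≤ D + (10 + 2 * L) := by
      have := norm_add_le (_root_.digamma (1 / 4 + I * x / 2) - _root_.digamma (1 / 4))
        (_root_.digamma (1 / 4))
      rw [sub_add_cancel] at this
      linarith
    refine (norm_add_le _ _).trans ?_
    rw [norm_neg, norm_mul, norm_mul, Complex.norm_real, Real.norm_of_nonneg hlogpi]
    norm_num
    linarith
  have hF := mul_le_mul hexp hψ' (norm_nonneg _) (by positivity)
  rw [← norm_mul] at hF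
  have hG : ‖1 / (2 * I * (x : ℂ)) * (_root_.digamma (1 / 4) - _root_.digamma (1 / 4 + I * x / 2))‖
      ≤ r / 2 * (10 + 2 * L) := by
    rw [norm_mul, hhalf, norm_sub_rev]
    gcongr
  have hH : ‖1 / (2 * I * (x : ℂ)) * (Real.exp (-t / 2) : ℂ) *
      (PhiC (Real.exp (-2 * t)) 1 (1 / 4) - PhiC (Real.exp (-2 * t)) 1 ((1 / 2 + I * x) / 2))‖
      ≤ r / 2 * 1 * (10 + 2 * L) := by
    rw [norm_mul, norm_mul, hhalf, Complex.norm_real, Real.norm_of_nonneg (Real.exp_pos _).le]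
    gcongr
    exact Real.exp_le_one_iff.mpr (by linarith)
  have hsplit : ∀ a b c e W p d f h : ℂ, a + b - c + e * (W - p + d) - f - h - e * W
      = a + b - c + e * (-p + d) - f - h := fun a b c e W p d f h => by ring
  rw [Pfrak, hsplit]
  refine (norm_sub_le_of_le (norm_sub_le_of_le (norm_add_le_of_le (norm_sub_le_of_le
    (norm_add_le_of_le hA hB) hS) hF) hG) hH).trans ?_
  have hrL : r ≤ r * L := le_mul_of_one_le_right hr0.le hL1
  have hcoef : 0 ≤ 4 * Real.exp (T / 2) + 4 + 2 * M + Real.log π + D + 20 := by positivity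
  have := mul_le_mul_of_nonneg_left hrL hcoef
  rw [← hM]
  nlinarith

/-- Unconditionally, for every compact `K ⊆ ℝ` there are `C > 0` and `X₀ > 0` such that
`|𝔖_t(x)| ≤ C |x|⁻¹ log|x|` for all `t ∈ K` and all real `x` with `|x| ≥ X₀`. -/
theorem statement19 (K : Set ℝ) (hK : IsCompact K) :
    ∃ C : ℝ, 0 < C ∧ ∃ X₀ : ℝ, 0 < X₀ ∧ ∀ t ∈ K, ∀ x : ℝ, X₀ ≤ |x| →
      ‖Sfrak t (x : ℂ)‖ ≤ C * |x|⁻¹ * Real.log |x| := by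
  obtain ⟨T, hT⟩ := hK.isBounded.exists_norm_le
  obtain ⟨C, hC0, hC⟩ := exists_norm_Pfrak_sub_le T
  refine ⟨2 * C + 12, by positivity, 3, by norm_num, fun t ht x hx => ?_⟩
  have hxpos : 0 < |x| := by linarith
  have hr0 : 0 < |x|⁻¹ := inv_pos.mpr hxpos
  have hL1 : 1 ≤ Real.log |x| := by
    rw [Real.le_log_iff_exp_le hxpos]
    linarith [Real.exp_one_lt_d9]
  have hrest := hC |t| (abs_nonneg t) (hT t ht) x hx
  have hpole := norm_one_add_Theta_mul_logDeriv_Zfun_le (x := x) (by linarith)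
  have hexp : ‖(Complex.exp (I * (|t| : ℝ) * x) - 1) / (I * x)‖ ≤ 2 * |x|⁻¹ := by
    have h := norm_exp_I_mul_ofReal_sub_one_div_le (|t| * x) x
    push_cast at h
    rwa [← mul_assoc] at h
  set e : ℂ := (Complex.exp (I * (|t| : ℝ) * x) - 1) / (I * x)
  set W : ℂ := deriv Zfun (1 / 2 - I * x) / Zfun (1 / 2 - I * x)
  have hconst : ‖I / (2 * (Real.sqrt π : ℂ))‖ ≤ 1 := by
    have hsqrt : 1 ≤ Real.sqrt π := Real.one_le_sqrt.mpr (by linarith [Real.pi_gt_three])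
    rw [norm_div, norm_mul, Complex.norm_I, Complex.norm_real, Complex.norm_ofNat,
      Real.norm_of_nonneg (by linarith)]
    exact (div_le_one (by linarith)).mpr (by linarith)
  have hsplit : Sfrak t x = I / (2 * (Real.sqrt π : ℂ)) *
      ((1 + Theta x) * (Pfrak |t| x - e * W) + e * ((1 + Theta x) * W)) := by
    rw [Sfrak]
    ring
  have h1 := mul_le_mul (norm_one_add_Theta_ofReal_le x) hrest (norm_nonneg _) (by norm_num)
  have h2 := mul_le_mul hexp hpole (norm_nonneg _) (by positivity)
  rw [← norm_mul] at h1 h2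
  rw [hsplit, norm_mul]
  refine (mul_le_of_le_one_left (norm_nonneg _) hconst).trans
    ((norm_add_le_of_le h1 h2).trans ?_)
  have hrL : |x|⁻¹ ≤ |x|⁻¹ * Real.log |x| := le_mul_of_one_le_right hr0.le hL1
  linarith
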